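/- Let P ⊆ ℝ^m and Q ⊆ ℝ^n be full-dimensional rational polytopes, i.e., P is the convex hull of a finite subset of ℚ^m with nonempty interior and Q is the convex hull of a finite subset of ℚ^n with nonempty interior, such that the origin of ℝ^m lies in P and the origin of ℝ^n lies in Q. Then (m+n)! · vol_{m+n}(P ⊕ Q) = (m! · vol_m(P)) · (n! · vol_n(Q)), where vol_k denotes k-dimensional Lebesgue measure. -/

import Mathlib

open MeasureTheory

section FreeSum

open Set Module
open scoped Pointwise ENNReal

/-- The positive dilation factors `t` for which `x` lies in `t • K`. -/
def dilationFactors {E : Type*} [SMul ℝ E] (K : Set E) (x : E) : Set ℝ :=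
  {t | 0 < t ∧ x ∈ t • K}

lemma lintegral_exp_neg_of_isUpperSet {A : Set ℝ} (hne : A.Nonempty) (hpos : ∀ t ∈ A, 0 < t)
    (hup : ∀ t ∈ A, ∀ s, t ≤ s → s ∈ A) :
    ∫⁻ t in A, ENNReal.ofReal (Real.exp (-t)) = ENNReal.ofReal (Real.exp (-sInf A)) := by
  have hbdd : BddBelow A := ⟨0, fun t ht => (hpos t ht).le⟩
  have hIoi : Ioi (sInf A) ⊆ A := fun s hs => by
    obtain ⟨t, ht, hts⟩ := exists_lt_of_csInf_lt hne hs
    exact hup t ht s hts.le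
  have hIci : A ⊆ Ici (sInf A) := fun t ht => csInf_le hbdd ht
  have hA : A =ᵐ[volume] Ioi (sInf A) :=
    ((hIci.eventuallyLE).trans Ioi_ae_eq_Ici.symm.le).antisymm hIoi.eventuallyLE
  rw [setLIntegral_congr hA, ← ofReal_integral_eq_lintegral_ofReal
    (integrableOn_exp_neg_Ioi _) (ae_of_all _ fun t => (Real.exp_pos _).le),
    integral_exp_neg_Ioi]

lemma lintegral_exp_neg_mul_pow (d : ℕ) :
    ∫⁻ t in Ioi (0 : ℝ), ENNReal.ofReal (Real.exp (-t)) * ENNReal.ofReal (t ^ d) =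
      (d.factorial : ℝ≥0∞) := by
  have hd : (0 : ℝ) < (d : ℝ) + 1 := by positivity
  have hint := Real.GammaIntegral_convergent hd
  have hval := Real.Gamma_eq_integral hd
  simp only [add_sub_cancel_right, Real.rpow_natCast, Real.Gamma_nat_eq_factorial] at hint hval
  rw [← ENNReal.ofReal_natCast, hval, ofReal_integral_eq_lintegral_ofReal hint]
  · exact lintegral_congr fun t => (ENNReal.ofReal_mul (Real.exp_pos _).le).symm
  · filter_upwards [ae_restrict_mem measurableSet_Ioi] with t ht
    have : (0 : ℝ) < t := ht
    positivity

section Single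

variable {E : Type*} [NormedAddCommGroup E] [NormedSpace ℝ E]

lemma dilationFactors_upward {K : Set E} (hK : Convex ℝ K) (h0 : (0 : E) ∈ K) {x : E} :
    ∀ t ∈ dilationFactors K x, ∀ s, t ≤ s → s ∈ dilationFactors K x := by
  rintro t ⟨ht, hx⟩ s hts
  have hs := ht.trans_le hts
  refine ⟨hs, ?_⟩
  rw [mem_smul_set_iff_inv_smul_mem₀ ht.ne'] at hx
  rw [mem_smul_set_iff_inv_smul_mem₀ hs.ne']
  have h := hK.smul_mem_of_zero_mem h0 hx (t := t / s)
    ⟨by positivity, (div_le_one hs).2 hts⟩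
  rwa [smul_smul, div_mul_eq_mul_div, mul_inv_cancel₀ ht.ne', one_div] at h

lemma lintegral_exp_neg_dilationFactors {K : Set E} (hK : Convex ℝ K) (h0 : (0 : E) ∈ K) {x : E}
    (hne : (dilationFactors K x).Nonempty) :
    ∫⁻ t in dilationFactors K x, ENNReal.ofReal (Real.exp (-t)) =
      ENNReal.ofReal (Real.exp (-sInf (dilationFactors K x))) :=
  lintegral_exp_neg_of_isUpperSet hne (fun _ h => h.1) (dilationFactors_upward hK h0)

variable [FiniteDimensional ℝ E] [MeasurableSpace E] [BorelSpace E]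

lemma measurableSet_dilation {K : Set E} (hK : MeasurableSet K) :
    MeasurableSet {p : E × ℝ | p.2 ∈ dilationFactors K p.1} := by
  have h : {p : E × ℝ | p.2 ∈ dilationFactors K p.1} =
      {p : E × ℝ | 0 < p.2} ∩ (fun p : E × ℝ => p.2⁻¹ • p.1) ⁻¹' K := by
    ext p
    exact and_congr_right fun hp => mem_smul_set_iff_inv_smul_mem₀ (ne_of_gt hp) _ _
  rw [h]
  exact (measurableSet_lt measurable_const measurable_snd).inter
    ((measurable_snd.inv.smul measurable_fst) hK)

lemma measurableSet_dilationFactors {K : Set E} (hK : MeasurableSet K) (x : E) :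
    MeasurableSet (dilationFactors K x) :=
  measurable_prodMk_left (measurableSet_dilation hK)

lemma measurable_indicator_dilationFactors {K : Set E} (hK : MeasurableSet K) :
    Measurable fun p : E × ℝ =>
      (dilationFactors K p.1).indicator (fun t => ENNReal.ofReal (Real.exp (-t))) p.2 := by
  have h : Measurable fun p : E × ℝ => ENNReal.ofReal (Real.exp (-p.2)) := by fun_prop
  exact h.indicator (measurableSet_dilation hK)

lemma measurable_lintegral_dilationFactors {K : Set E} (hK : MeasurableSet K) :
    Measurable fun x => ∫⁻ t in dilationFactors K x, ENNReal.ofReal (Real.exp (-t)) := by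
  simp_rw [← lintegral_indicator (measurableSet_dilationFactors hK _)]
  exact (measurable_indicator_dilationFactors hK).lintegral_prod_right'

/-- Integrating `exp (-h)`, where `h` is the extended gauge of `K`, computes the normalized volume
of `K`. -/
lemma lintegral_dilationFactors (μ : Measure E) [μ.IsAddHaarMeasure] {K : Set E}
    (hK : MeasurableSet K) :
    ∫⁻ x, (∫⁻ t in dilationFactors K x, ENNReal.ofReal (Real.exp (-t))) ∂μ =
      ((finrank ℝ E).factorial : ℝ≥0∞) * μ K := by
  simp_rw [← lintegral_indicator (measurableSet_dilationFactors hK _)]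
  rw [lintegral_lintegral_swap (measurable_indicator_dilationFactors hK).aemeasurable,
    ← lintegral_exp_neg_mul_pow, ← lintegral_mul_const _ (by fun_prop),
    ← lintegral_indicator measurableSet_Ioi]
  refine lintegral_congr fun t => ?_
  by_cases ht : 0 < t
  · have hmeas : MeasurableSet (t • K) := hK.const_smul₀ t
    have h : ∀ x : E, (dilationFactors K x).indicator (fun t => ENNReal.ofReal (Real.exp (-t))) t =
        (t • K).indicator (fun _ => ENNReal.ofReal (Real.exp (-t))) x := fun x => by
      by_cases hx : x ∈ t • K
      · rw [indicator_of_mem hx, indicator_of_mem (show t ∈ dilationFactors K x from ⟨ht, hx⟩)]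
      · rw [indicator_of_notMem hx, indicator_of_notMem fun h => hx h.2]
    simp_rw [h]
    rw [lintegral_indicator_const hmeas, indicator_of_mem (show t ∈ Ioi (0 : ℝ) from ht),
      Measure.addHaar_smul, abs_of_pos (by positivity), mul_assoc]
  · rw [indicator_of_notMem (by simpa using ht)]
    simp_rw [indicator_of_notMem fun h : t ∈ dilationFactors K _ => ht h.1]
    exact lintegral_zero

end Single

variable {E F : Type*} [NormedAddCommGroup E] [NormedSpace ℝ E]
  [NormedAddCommGroup F] [NormedSpace ℝ F]

/-- The free sum of two sets. -/
def freeSum (P : Set E) (Q : Set F) : Set (E × F) :=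
  convexHull ℝ ((P ×ˢ ({0} : Set F)) ∪ (({0} : Set E) ×ˢ Q))

lemma mem_freeSum_iff {P : Set E} {Q : Set F} (hP : Convex ℝ P) (hQ : Convex ℝ Q)
    (hP0 : (0 : E) ∈ P) (hQ0 : (0 : F) ∈ Q) {z : E × F} :
    z ∈ freeSum P Q ↔
      ∃ a b : ℝ, 0 ≤ a ∧ 0 ≤ b ∧ a + b = 1 ∧ z.1 ∈ a • P ∧ z.2 ∈ b • Q := by
  have hPne : (P ×ˢ ({0} : Set F)).Nonempty := ⟨(0, 0), hP0, rfl⟩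
  have hQne : (({0} : Set E) ×ˢ Q).Nonempty := ⟨(0, 0), rfl, hQ0⟩
  rw [freeSum, (hP.prod (convex_singleton (0 : F))).convexHull_union
    ((convex_singleton (0 : E)).prod hQ) hPne hQne, mem_convexJoin]
  constructor
  · rintro ⟨⟨p, p'⟩, ⟨hp, rfl : p' = 0⟩, ⟨q', q⟩, ⟨rfl : q' = 0, hq⟩, a, b, ha, hb, hab, rfl⟩
    exact ⟨a, b, ha, hb, hab, ⟨p, hp, by simp⟩, ⟨q, hq, by simp⟩⟩
  · rintro ⟨a, b, ha, hb, hab, ⟨p, hp, hpz⟩, ⟨q, hq, hqz⟩⟩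
    refine ⟨(p, 0), ⟨hp, rfl⟩, (0, q), ⟨rfl, hq⟩, a, b, ha, hb, hab, ?_⟩
    ext <;> simp [← hpz, ← hqz]

lemma mem_dilationFactors_freeSum_iff {P : Set E} {Q : Set F} (hP : Convex ℝ P) (hQ : Convex ℝ Q)
    (hP0 : (0 : E) ∈ P) (hQ0 : (0 : F) ∈ Q) {z : E × F} {s : ℝ} :
    s ∈ dilationFactors (freeSum P Q) z ↔
      0 < s ∧ ∃ a b : ℝ, 0 ≤ a ∧ 0 ≤ b ∧ a + b = s ∧ z.1 ∈ a • P ∧ z.2 ∈ b • Q := by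
  refine and_congr_right fun hs => ?_
  rw [mem_smul_set_iff_inv_smul_mem₀ hs.ne', mem_freeSum_iff hP hQ hP0 hQ0]
  constructor
  · rintro ⟨a, b, ha, hb, hab, hx, hy⟩
    refine ⟨s * a, s * b, by positivity, by positivity, by rw [← mul_add, hab, mul_one], ?_, ?_⟩
    · rw [mul_smul, mem_smul_set_iff_inv_smul_mem₀ hs.ne']
      exact hx
    · rw [mul_smul, mem_smul_set_iff_inv_smul_mem₀ hs.ne']
      exact hy
  · rintro ⟨a, b, ha, hb, hab, hx, hy⟩
    refine ⟨s⁻¹ * a, s⁻¹ * b, by positivity, by positivity,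
      by rw [← mul_add, hab, inv_mul_cancel₀ hs.ne'], ?_, ?_⟩
    · rw [mul_smul]
      exact smul_mem_smul_set hx
    · rw [mul_smul]
      exact smul_mem_smul_set hy

lemma mem_dilationFactors_of_lt {K : Set E} (hK : Convex ℝ K) (h0 : (0 : E) ∈ K) {x : E} {a s : ℝ}
    (ha : 0 ≤ a) (hx : x ∈ a • K) (has : a < s) : s ∈ dilationFactors K x := by
  rcases ha.eq_or_lt with rfl | ha
  · refine ⟨has, 0, h0, ?_⟩
    obtain ⟨k, -, rfl⟩ := hx
    simp
  · exact dilationFactors_upward hK h0 a ⟨ha, hx⟩ s has.le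

lemma lintegral_dilationFactors_freeSum {P : Set E} {Q : Set F}
    (hP : Convex ℝ P) (hQ : Convex ℝ Q) (hP0 : (0 : E) ∈ P) (hQ0 : (0 : F) ∈ Q) (z : E × F) :
    ∫⁻ t in dilationFactors (freeSum P Q) z, ENNReal.ofReal (Real.exp (-t)) =
      (∫⁻ t in dilationFactors P z.1, ENNReal.ofReal (Real.exp (-t))) *
        ∫⁻ t in dilationFactors Q z.2, ENNReal.ofReal (Real.exp (-t)) := by
  have hadd : ∀ a ∈ dilationFactors P z.1, ∀ b ∈ dilationFactors Q z.2,
      a + b ∈ dilationFactors (freeSum P Q) z := fun a ha b hb =>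
    (mem_dilationFactors_freeSum_iff hP hQ hP0 hQ0).2
      ⟨add_pos ha.1 hb.1, a, b, ha.1.le, hb.1.le, rfl, ha.2, hb.2⟩
  have hsplit : ∀ s ∈ dilationFactors (freeSum P Q) z, ∃ a b : ℝ, a + b = s ∧
      (∀ c, a < c → c ∈ dilationFactors P z.1) ∧ (∀ c, b < c → c ∈ dilationFactors Q z.2) := by
    intro s hs
    obtain ⟨-, a, b, ha, hb, hab, hx, hy⟩ := (mem_dilationFactors_freeSum_iff hP hQ hP0 hQ0).1 hs
    exact ⟨a, b, hab, fun c hc => mem_dilationFactors_of_lt hP hP0 ha hx hc,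
      fun c hc => mem_dilationFactors_of_lt hQ hQ0 hb hy hc⟩
  by_cases hne : (dilationFactors (freeSum P Q) z).Nonempty
  · obtain ⟨s, hs⟩ := hne
    obtain ⟨a, b, -, ha, hb⟩ := hsplit s hs
    have hPne : (dilationFactors P z.1).Nonempty := ⟨a + 1, ha _ (lt_add_one a)⟩
    have hQne : (dilationFactors Q z.2).Nonempty := ⟨b + 1, hb _ (lt_add_one b)⟩
    have hPb : BddBelow (dilationFactors P z.1) := ⟨0, fun t ht => ht.1.le⟩
    have hQb : BddBelow (dilationFactors Q z.2) := ⟨0, fun t ht => ht.1.le⟩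
    have hRb : BddBelow (dilationFactors (freeSum P Q) z) := ⟨0, fun t ht => ht.1.le⟩
    have hInf : sInf (dilationFactors (freeSum P Q) z) =
        sInf (dilationFactors P z.1) + sInf (dilationFactors Q z.2) := by
      apply le_antisymm
      · rw [← csInf_add hPne hPb hQne hQb]
        refine le_csInf (hPne.add hQne) ?_
        rintro _ ⟨a, ha, b, hb, rfl⟩
        exact csInf_le hRb (hadd a ha b hb)
      · refine le_csInf ⟨s, hs⟩ fun r hr => ?_
        obtain ⟨a, b, rfl, ha, hb⟩ := hsplit r hr
        exact add_le_add (le_of_forall_gt_imp_ge_of_dense fun c hc => csInf_le hPb (ha c hc))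
          (le_of_forall_gt_imp_ge_of_dense fun c hc => csInf_le hQb (hb c hc))
    have hR : Convex ℝ (freeSum P Q) := convex_convexHull ℝ _
    have hR0 : (0 : E × F) ∈ freeSum P Q := subset_convexHull ℝ _ (Or.inl ⟨hP0, rfl⟩)
    rw [lintegral_exp_neg_dilationFactors hP hP0 hPne, lintegral_exp_neg_dilationFactors hQ hQ0 hQne,
      lintegral_exp_neg_dilationFactors hR hR0 ⟨s, hs⟩, hInf, neg_add,
      Real.exp_add, ENNReal.ofReal_mul (Real.exp_pos _).le]
  · have h : dilationFactors P z.1 = ∅ ∨ dilationFactors Q z.2 = ∅ := by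
      by_contra! h
      obtain ⟨⟨a, ha⟩, ⟨b, hb⟩⟩ := h
      exact hne ⟨a + b, hadd a ha b hb⟩
    rw [not_nonempty_iff_eq_empty.1 hne]
    rcases h with h | h <;> simp [h]

lemma isCompact_freeSum {P : Set E} {Q : Set F} (hP : Convex ℝ P) (hQ : Convex ℝ Q)
    (hP0 : (0 : E) ∈ P) (hQ0 : (0 : F) ∈ Q) (hPc : IsCompact P) (hQc : IsCompact Q) :
    IsCompact (freeSum P Q) := by
  have h : freeSum P Q = (fun w : ℝ × E × F => (w.1 • w.2.1, (1 - w.1) • w.2.2)) ''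
      (Icc 0 1 ×ˢ P ×ˢ Q) := by
    ext z
    rw [mem_freeSum_iff hP hQ hP0 hQ0]
    constructor
    · rintro ⟨a, b, ha, hb, hab, ⟨p, hp, hpz⟩, ⟨q, hq, hqz⟩⟩
      obtain rfl : b = 1 - a := by linarith
      exact ⟨(a, p, q), ⟨⟨ha, by linarith⟩, hp, hq⟩, Prod.ext hpz hqz⟩
    · rintro ⟨⟨a, p, q⟩, ⟨⟨ha, ha1⟩, hp, hq⟩, rfl⟩
      exact ⟨a, 1 - a, ha, by simpa using ha1, by ring, smul_mem_smul_set hp,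
        smul_mem_smul_set hq⟩
  rw [h]
  exact (isCompact_Icc.prod (hPc.prod hQc)).image (by fun_prop)

/-- The normalized volume is multiplicative for free sums of compact convex sets containing the
origin. -/
theorem factorial_mul_measure_freeSum [FiniteDimensional ℝ E] [MeasurableSpace E] [BorelSpace E]
    [FiniteDimensional ℝ F] [MeasurableSpace F] [BorelSpace F]
    (μ : Measure E) [μ.IsAddHaarMeasure] (ν : Measure F) [ν.IsAddHaarMeasure]
    {P : Set E} {Q : Set F} (hP : Convex ℝ P) (hQ : Convex ℝ Q)
    (hP0 : (0 : E) ∈ P) (hQ0 : (0 : F) ∈ Q) (hPc : IsCompact P) (hQc : IsCompact Q) :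
    ((finrank ℝ E + finrank ℝ F).factorial : ℝ≥0∞) * (μ.prod ν) (freeSum P Q) =
      ((finrank ℝ E).factorial * μ P) * ((finrank ℝ F).factorial * ν Q) := by
  have hR := (isCompact_freeSum hP hQ hP0 hQ0 hPc hQc).measurableSet
  rw [← finrank_prod, ← lintegral_dilationFactors (μ.prod ν) hR,
    ← lintegral_dilationFactors μ hPc.measurableSet,
    ← lintegral_dilationFactors ν hQc.measurableSet]
  simp_rw [lintegral_dilationFactors_freeSum hP hQ hP0 hQ0]
  exact lintegral_prod_mul (measurable_lintegral_dilationFactors hPc.measurableSet).aemeasurable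
    (measurable_lintegral_dilationFactors hQc.measurableSet).aemeasurable

end FreeSum

/-- The product formula for the normalized volume of a free sum of two
full-dimensional *rational* polytopes containing the origin. -/
theorem free_sum_normalized_volume_product_rational
    (m n : ℕ) (S : Finset (Fin m → ℝ)) (T : Finset (Fin n → ℝ))
    (hS : ∀ v ∈ S, ∀ i, ∃ q : ℚ, v i = (q : ℝ))
    (hT : ∀ w ∈ T, ∀ j, ∃ q : ℚ, w j = (q : ℝ))
    (P : Set (Fin m → ℝ)) (Q : Set (Fin n → ℝ))
    (hP : P = convexHull ℝ (S : Set (Fin m → ℝ)))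
    (hQ : Q = convexHull ℝ (T : Set (Fin n → ℝ)))
    (hPfull : (interior P).Nonempty) (hQfull : (interior Q).Nonempty)
    (hP0 : (0 : Fin m → ℝ) ∈ P) (hQ0 : (0 : Fin n → ℝ) ∈ Q) :
    (Nat.factorial (m + n) : ℝ) *
        (volume (convexHull ℝ
          ((P ×ˢ ({0} : Set (Fin n → ℝ))) ∪ (({0} : Set (Fin m → ℝ)) ×ˢ Q)))).toReal
      = ((Nat.factorial m : ℝ) * (volume P).toReal) *
        ((Nat.factorial n : ℝ) * (volume Q).toReal) := by
  have hPconv : Convex ℝ P := hP ▸ convex_convexHull ℝ _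
  have hQconv : Convex ℝ Q := hQ ▸ convex_convexHull ℝ _
  have hPc : IsCompact P := hP ▸ S.finite_toSet.isCompact_convexHull ℝ
  have hQc : IsCompact Q := hQ ▸ T.finite_toSet.isCompact_convexHull ℝ
  have h := congrArg ENNReal.toReal
    (factorial_mul_measure_freeSum volume volume hPconv hQconv hP0 hQ0 hPc hQc)
  simpa only [Module.finrank_fin_fun, ENNReal.toReal_mul, ENNReal.toReal_natCast, freeSum,
    ← Measure.volume_eq_prod] using h
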